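/- Let x ∈ ℝⁿ with Cx ≠ 0, let α ∈ ℝ, σ > 0, and let y ~ N(α·1ₙ, σ²·Iₙ). Then Cy ≠ 0 almost surely, and for every r ∈ [0, 1], the correlation R = (Cx)ᵀ(Cy)/(‖Cx‖·‖Cy‖) satisfies P(R > r) = (1 − F(r²; 1/2, (n−2)/2))/2, where F(·; a, b) is the cumulative distribution function of the beta distribution with parameters a, b > 0. -/

import Mathlib

open Matrix Finset MeasureTheory ProbabilityTheory

/-- The centering matrix `C = Iₙ − n⁻¹·1ₙ1ₙᵀ`. -/
noncomputable def Cmat (n : ℕ) : Matrix (Fin n) (Fin n) ℝ :=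
  Matrix.of fun i j => (if i = j then 1 else 0) - 1 / n

/-- Euclidean norm on `ℝⁿ`. -/
noncomputable def enorm' {n : ℕ} (v : Fin n → ℝ) : ℝ := Real.sqrt (∑ i, v i ^ 2)

/-- The correlation coefficient `R = (Cx)ᵀ(Cy)/(‖Cx‖·‖Cy‖)`. -/
noncomputable def corrR {n : ℕ} (x y : Fin n → ℝ) : ℝ :=
  ((Cmat n *ᵥ x) ⬝ᵥ (Cmat n *ᵥ y)) / (enorm' (Cmat n *ᵥ x) * enorm' (Cmat n *ᵥ y))

/-- The CDF of the beta distribution with parameters `a, b > 0`. -/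
noncomputable def betaCDF (a b t : ℝ) : ℝ :=
  (∫ x in (0 : ℝ)..t, x ^ (a - 1) * (1 - x) ^ (b - 1)) /
    (∫ x in (0 : ℝ)..1, x ^ (a - 1) * (1 - x) ^ (b - 1))

theorem pi_withDensity_prod {ι : Type*} [Fintype ι] {X : ι → Type*}
    [∀ i, MeasurableSpace (X i)] (μ : ∀ i, Measure (X i)) [∀ i, IsProbabilityMeasure (μ i)]
    {f : ∀ i, X i → ENNReal} (hf : ∀ i, Measurable (f i))
    [∀ i, SigmaFinite ((μ i).withDensity (f i))] :
    (Measure.pi μ).withDensity (fun x => ∏ i, f i (x i)) =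
      Measure.pi fun i => (μ i).withDensity (f i) := by
  refine (Measure.pi_eq fun s hs => ?_).symm
  rw [withDensity_apply _ (MeasurableSet.univ_pi hs), ← lintegral_indicator (.univ_pi hs)]
  have hprod (x : ∀ i, X i) :
      (Set.univ.pi s).indicator (fun x => ∏ i, f i (x i)) x =
        ∏ i, (s i).indicator (f i) (x i) := by
    classical
    by_cases hx : x ∈ Set.univ.pi s
    · rw [Set.indicator_of_mem hx]
      exact Finset.prod_congr rfl fun i _ => (Set.indicator_of_mem (hx i trivial) _).symm
    · rw [Set.indicator_of_notMem hx]
      obtain ⟨i, hi⟩ : ∃ i, x i ∉ s i := by simpa [Set.mem_pi] using hx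
      exact (Finset.prod_eq_zero (Finset.mem_univ i) (Set.indicator_of_notMem hi _)).symm
  have hmeas (i : ι) : Measurable ((s i).indicator (f i)) := (hf i).indicator (hs i)
  simp_rw [hprod]
  refine (lintegral_prod_eq_prod_lintegral_of_indepFun Finset.univ
    (fun i (x : ∀ i, X i) => (s i).indicator (f i) (x i))
    (iIndepFun_pi fun i => (hmeas i).aemeasurable)
    fun i => (hmeas i).comp (measurable_pi_apply i)).trans ?_
  refine Finset.prod_congr rfl fun i _ => ?_
  rw [(measurePreserving_eval μ i).lintegral_comp (hmeas i), lintegral_indicator (hs i),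
    withDensity_apply _ (hs i)]

theorem gaussianReal_withDensity_exp_sq {b : ℝ} (hb : 0 < b) :
    (gaussianReal 0 1).withDensity
        (fun x => ENNReal.ofReal (b⁻¹ * Real.exp (-((b ^ 2)⁻¹ - 1) * x ^ 2 / 2))) =
      (gaussianReal 0 1).map (b * ·) := by
  rw [gaussianReal_map_const_mul, gaussianReal_of_var_ne_zero _ one_ne_zero,
    gaussianReal_of_var_ne_zero, ← withDensity_mul _ (measurable_gaussianPDF _ _) (by fun_prop)]
  · congr 1
    ext x
    rw [Pi.mul_apply, gaussianPDF_def, gaussianPDF_def,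
      ← ENNReal.ofReal_mul (gaussianPDFReal_nonneg _ _ _)]
    congr 1
    simp only [gaussianPDFReal, NNReal.coe_one, mul_one, NNReal.coe_mk, mul_zero, sub_zero]
    rw [Real.sqrt_mul (x := 2 * Real.pi) (by positivity) (b ^ 2), Real.sqrt_sq hb.le,
      mul_inv, mul_assoc, mul_assoc]
    congr 1
    rw [mul_left_comm, ← Real.exp_add]
    congr 2
    field_simp
    ring
  · rw [← NNReal.coe_ne_zero]
    simpa using hb.ne'

theorem lintegral_pi_gaussianReal_scale {ι : Type*} [Fintype ι] {b : ℝ} (hb : 0 < b)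
    {f : (ι → ℝ) → ENNReal} (hf : Measurable f) :
    ∫⁻ w, ENNReal.ofReal ((b⁻¹) ^ Fintype.card ι *
        Real.exp (-((b ^ 2)⁻¹ - 1) * (∑ i, w i ^ 2) / 2)) * f w
        ∂(Measure.pi fun _ : ι => gaussianReal 0 1) =
      ∫⁻ w, f (b • w) ∂(Measure.pi fun _ : ι => gaussianReal 0 1) := by
  have : IsProbabilityMeasure ((gaussianReal 0 1).map (b * ·)) :=
    Measure.isProbabilityMeasure_map (by fun_prop)
  have : SigmaFinite ((gaussianReal 0 1).withDensity
      (fun x => ENNReal.ofReal (b⁻¹ * Real.exp (-((b ^ 2)⁻¹ - 1) * x ^ 2 / 2)))) := by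
    rw [gaussianReal_withDensity_exp_sq hb]; infer_instance
  have key := pi_withDensity_prod (fun _ : ι => gaussianReal 0 1)
    (f := fun _ x => ENNReal.ofReal (b⁻¹ * Real.exp (-((b ^ 2)⁻¹ - 1) * x ^ 2 / 2)))
    (fun i => by fun_prop)
  simp_rw [gaussianReal_withDensity_exp_sq hb] at key
  rw [← Measure.pi_map_pi (fun i => by fun_prop)] at key
  have hmap : ∫⁻ w, f (b • w) ∂(Measure.pi fun _ : ι => gaussianReal 0 1) =
      ∫⁻ w, f w ∂((Measure.pi fun _ : ι => gaussianReal 0 1).map fun x i => b * x i) := by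
    rw [lintegral_map hf (by fun_prop)]
    rfl
  rw [hmap, ← key, lintegral_withDensity_eq_lintegral_mul _ (by fun_prop) hf]
  refine lintegral_congr fun w => ?_
  rw [Pi.mul_apply, ← ENNReal.ofReal_prod_of_nonneg (fun i _ => by positivity),
    Finset.prod_mul_distrib, ← Real.exp_sum, Finset.prod_const, Finset.mul_sum, Finset.sum_div,
    Finset.card_univ]

theorem hasDerivAt_sqrt_div_one_sub {v : ℝ} (h0 : 0 < v) (h1 : v < 1) :
    HasDerivAt (fun v : ℝ => √(v / (1 - v)))
      (1 / 2 * v ^ (-(1 / 2) : ℝ) * (1 - v) ^ (-(3 / 2) : ℝ)) v := by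
  have h1' : 0 < 1 - v := sub_pos.2 h1
  have hd : HasDerivAt (fun v : ℝ => v / (1 - v)) ((1 * (1 - v) - v * (-1)) / (1 - v) ^ 2) v :=
    (hasDerivAt_id v).div ((hasDerivAt_id v).const_sub 1) h1'.ne'
  convert! hd.sqrt (div_pos h0 h1').ne' using 1
  have hv : v ^ (-(1 / 2) : ℝ) = (√v)⁻¹ := by rw [Real.rpow_neg h0.le, ← Real.sqrt_eq_rpow]
  have hw : (1 - v) ^ (-(3 / 2) : ℝ) = ((1 - v) * √(1 - v))⁻¹ := by
    rw [Real.rpow_neg h1'.le, show (3 / 2 : ℝ) = 1 + 1 / 2 by norm_num, Real.rpow_add h1',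
      Real.rpow_one, ← Real.sqrt_eq_rpow]
  have hs : 0 < √(1 - v) := Real.sqrt_pos.2 h1'
  have hs' : 0 < √v := Real.sqrt_pos.2 h0
  rw [hv, hw, Real.sqrt_div h0.le]
  field_simp
  rw [Real.sq_sqrt h1'.le]
  ring

theorem image_mul_sqrt_div_one_sub_Ioo {W q : ℝ} (hW : 0 < W) (hq0 : 0 ≤ q) (hq1 : q < 1) :
    (fun v : ℝ => W * √(v / (1 - v))) '' Set.Ioo q 1 = Set.Ioi (W * √(q / (1 - q))) := by
  ext t
  simp only [Set.mem_image, Set.mem_Ioo, Set.mem_Ioi]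
  constructor
  · rintro ⟨v, ⟨hqv, hv1⟩, rfl⟩
    have : 0 < 1 - q := by linarith
    have : 0 < 1 - v := by linarith
    have : 0 ≤ v := by linarith
    gcongr
  · intro ht
    have ht0 : 0 < t := lt_of_le_of_lt (by positivity) ht
    have hq : q / (1 - q) < (t / W) ^ 2 := by
      rw [← Real.sqrt_lt' (by positivity), lt_div_iff₀' hW]
      exact ht
    rw [div_lt_iff₀ (by linarith)] at hq
    refine ⟨(t / W) ^ 2 / (1 + (t / W) ^ 2), ⟨?_, ?_⟩, ?_⟩
    · rw [lt_div_iff₀ (by positivity)]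
      linarith
    · rw [div_lt_one (by positivity)]
      linarith
    · rw [show (t / W) ^ 2 / (1 + (t / W) ^ 2) / (1 - (t / W) ^ 2 / (1 + (t / W) ^ 2)) =
        (t / W) ^ 2 by field_simp; ring, Real.sqrt_sq (by positivity)]
      field_simp

theorem gaussianReal_Ioi_mul_sqrt_div_one_sub {W q : ℝ} (hW : 0 < W) (hq0 : 0 ≤ q) (hq1 : q < 1) :
    gaussianReal 0 1 (Set.Ioi (W * √(q / (1 - q)))) =
      ∫⁻ v in Set.Ioo q 1, ENNReal.ofReal ((√(2 * Real.pi))⁻¹ *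
          (1 / 2 * v ^ (-(1 / 2) : ℝ) * (1 - v) ^ (-(3 / 2) : ℝ))) *
        (ENNReal.ofReal (Real.exp (-(v / (1 - v)) * W ^ 2 / 2)) * ENNReal.ofReal W) := by
  have hinj : Set.InjOn (fun v : ℝ => W * √(v / (1 - v))) (Set.Ioo q 1) := by
    refine StrictMonoOn.injOn fun a ha b hb hab => ?_
    have : 0 < 1 - a := by linarith [ha.2]
    have : 0 < 1 - b := by linarith [hb.2]
    have : 0 ≤ a := hq0.trans ha.1.le
    have : 0 ≤ b := hq0.trans hb.1.le
    gcongr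
  rw [gaussianReal_apply _ one_ne_zero, ← image_mul_sqrt_div_one_sub_Ioo hW hq0 hq1,
    lintegral_image_eq_lintegral_abs_deriv_mul measurableSet_Ioo
      (fun v hv => ((hasDerivAt_sqrt_div_one_sub (hq0.trans_lt hv.1) hv.2).const_mul
        W).hasDerivWithinAt) hinj]
  refine setLIntegral_congr_fun measurableSet_Ioo fun v hv => ?_
  have h0 : 0 < v := hq0.trans_lt hv.1
  have h1 : 0 < 1 - v := sub_pos.2 hv.2
  rw [gaussianPDF_def, ← ENNReal.ofReal_mul (by positivity), ← ENNReal.ofReal_mul (by positivity),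
    ← ENNReal.ofReal_mul (by positivity), abs_of_nonneg (by positivity)]
  congr 1
  simp only [gaussianPDFReal, NNReal.coe_one, mul_one, sub_zero]
  rw [mul_pow, Real.sq_sqrt (by positivity),
    show -(v / (1 - v)) * W ^ 2 / 2 = -(W ^ 2 * (v / (1 - v))) / 2 by ring]
  ring

theorem ae_pi_gaussianReal_sqrt_sum_sq_pos {ι : Type*} [Fintype ι] [Nonempty ι] :
    ∀ᵐ w ∂(Measure.pi fun _ : ι => gaussianReal 0 1), 0 < √(∑ i, w i ^ 2) := by
  have : NullSingletonClass (gaussianReal 0 1) := nullSingletonClass_gaussianReal one_ne_zero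
  have h : ∀ᵐ w ∂(Measure.pi fun _ : ι => gaussianReal 0 1), w ≠ 0 := by
    rw [ae_iff]
    simp
  filter_upwards [h] with w hw
  obtain ⟨i, hi⟩ := Function.ne_iff.1 hw
  exact Real.sqrt_pos.2 (Finset.sum_pos' (fun i _ => sq_nonneg _)
    ⟨i, Finset.mem_univ i, by have : w i ≠ 0 := hi; positivity⟩)

theorem lintegral_exp_mul_sqrt_sum_sq {ι : Type*} [Fintype ι] {v : ℝ} (h1 : v < 1) :
    ∫⁻ w, ENNReal.ofReal (Real.exp (-(v / (1 - v)) * √(∑ i, w i ^ 2) ^ 2 / 2)) *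
        ENNReal.ofReal √(∑ i, w i ^ 2) ∂(Measure.pi fun _ : ι => gaussianReal 0 1) =
      ENNReal.ofReal ((1 - v) ^ (((Fintype.card ι : ℝ) + 1) / 2)) *
        ∫⁻ w, ENNReal.ofReal √(∑ i, w i ^ 2) ∂(Measure.pi fun _ : ι => gaussianReal 0 1) := by
  have h1' : 0 < 1 - v := sub_pos.2 h1
  have hb : 0 < √(1 - v) := Real.sqrt_pos.2 h1'
  have key := lintegral_pi_gaussianReal_scale hb (ι := ι)
    (f := fun w => ENNReal.ofReal √(∑ i, w i ^ 2)) (by fun_prop)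
  have hl (w : ι → ℝ) : ENNReal.ofReal (Real.exp (-(v / (1 - v)) * √(∑ i, w i ^ 2) ^ 2 / 2)) *
        ENNReal.ofReal √(∑ i, w i ^ 2) = ENNReal.ofReal (√(1 - v) ^ Fintype.card ι) *
      (ENNReal.ofReal ((√(1 - v))⁻¹ ^ Fintype.card ι *
        Real.exp (-((√(1 - v) ^ 2)⁻¹ - 1) * (∑ i, w i ^ 2) / 2)) *
          ENNReal.ofReal √(∑ i, w i ^ 2)) := by
    rw [← mul_assoc, ← ENNReal.ofReal_mul (p := √(1 - v) ^ Fintype.card ι) (by positivity),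
      ← mul_assoc (√(1 - v) ^ Fintype.card ι), ← mul_pow, mul_inv_cancel₀ hb.ne', one_pow,
      one_mul, Real.sq_sqrt (by positivity),
      Real.sq_sqrt h1'.le]
    congr 4
    field_simp
    ring
  have hr (w : ι → ℝ) : ENNReal.ofReal √(∑ i, (√(1 - v) • w) i ^ 2) =
      ENNReal.ofReal √(1 - v) * ENNReal.ofReal √(∑ i, w i ^ 2) := by
    simp only [Pi.smul_apply, smul_eq_mul, mul_pow]
    rw [← Finset.mul_sum, Real.sqrt_mul (by positivity), Real.sqrt_sq hb.le,
      ENNReal.ofReal_mul hb.le]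
  simp_rw [hl]
  rw [lintegral_const_mul _ (by fun_prop), key]
  simp_rw [hr]
  rw [lintegral_const_mul _ (by fun_prop), ← mul_assoc, ← ENNReal.ofReal_mul (by positivity),
    ← pow_succ, Real.sqrt_eq_rpow, ← Real.rpow_natCast, ← Real.rpow_mul h1'.le]
  congr 3
  push_cast
  ring

theorem exists_gaussianReal_prod_pi_apply_eq {ι : Type*} [Fintype ι] [Nonempty ι] :
    ∃ A : ENNReal, ∀ q : ℝ, 0 ≤ q → q < 1 →
      ((gaussianReal 0 1).prod (Measure.pi fun _ : ι => gaussianReal 0 1))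
        {p | √(∑ i, p.2 i ^ 2) * √(q / (1 - q)) < p.1} =
      A * ∫⁻ v in Set.Ioo q 1, ENNReal.ofReal
        (v ^ ((1 / 2 : ℝ) - 1) * (1 - v) ^ ((Fintype.card ι : ℝ) / 2 - 1)) := by
  set γ := Measure.pi fun _ : ι => gaussianReal 0 1 with hγ
  refine ⟨ENNReal.ofReal ((√(2 * Real.pi))⁻¹ * (1 / 2)) * ∫⁻ w, ENNReal.ofReal √(∑ i, w i ^ 2) ∂γ,
    fun q hq0 hq1 => ?_⟩
  have hmeas : MeasurableSet {p : ℝ × (ι → ℝ) | √(∑ i, p.2 i ^ 2) * √(q / (1 - q)) < p.1} :=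
    measurableSet_lt (by fun_prop) (by fun_prop)
  rw [Measure.prod_apply_symm hmeas]
  calc ∫⁻ w, gaussianReal 0 1 ((fun t => (t, w)) ⁻¹'
          {p : ℝ × (ι → ℝ) | √(∑ i, p.2 i ^ 2) * √(q / (1 - q)) < p.1}) ∂γ
      = ∫⁻ w, (∫⁻ v in Set.Ioo q 1, ENNReal.ofReal ((√(2 * Real.pi))⁻¹ *
          (1 / 2 * v ^ (-(1 / 2) : ℝ) * (1 - v) ^ (-(3 / 2) : ℝ))) *
        (ENNReal.ofReal (Real.exp (-(v / (1 - v)) * √(∑ i, w i ^ 2) ^ 2 / 2)) *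
          ENNReal.ofReal √(∑ i, w i ^ 2))) ∂γ := by
        refine lintegral_congr_ae ?_
        filter_upwards [ae_pi_gaussianReal_sqrt_sum_sq_pos (ι := ι)] with w hw
        exact gaussianReal_Ioi_mul_sqrt_div_one_sub hw hq0 hq1
    _ = ∫⁻ v in Set.Ioo q 1, ∫⁻ w, ENNReal.ofReal ((√(2 * Real.pi))⁻¹ *
          (1 / 2 * v ^ (-(1 / 2) : ℝ) * (1 - v) ^ (-(3 / 2) : ℝ))) *
        (ENNReal.ofReal (Real.exp (-(v / (1 - v)) * √(∑ i, w i ^ 2) ^ 2 / 2)) *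
          ENNReal.ofReal √(∑ i, w i ^ 2)) ∂γ :=
        lintegral_lintegral_swap (by fun_prop)
    _ = ∫⁻ v in Set.Ioo q 1, (ENNReal.ofReal ((√(2 * Real.pi))⁻¹ * (1 / 2)) *
          ∫⁻ w, ENNReal.ofReal √(∑ i, w i ^ 2) ∂γ) * ENNReal.ofReal
            (v ^ ((1 / 2 : ℝ) - 1) * (1 - v) ^ ((Fintype.card ι : ℝ) / 2 - 1)) := by
        refine setLIntegral_congr_fun measurableSet_Ioo fun v hv => ?_
        have h0 : 0 < v := hq0.trans_lt hv.1
        have h1 : 0 < 1 - v := sub_pos.2 hv.2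
        rw [lintegral_const_mul _ (by fun_prop), hγ, lintegral_exp_mul_sqrt_sum_sq hv.2,
          ← mul_assoc, ← ENNReal.ofReal_mul (by positivity),
          mul_right_comm (ENNReal.ofReal ((√(2 * Real.pi))⁻¹ * (1 / 2))),
          ← ENNReal.ofReal_mul (by positivity)]
        congr 2
        rw [show (1 / 2 : ℝ) - 1 = -(1 / 2) by norm_num,
          show (Fintype.card ι : ℝ) / 2 - 1 = -(3 / 2) + ((Fintype.card ι : ℝ) + 1) / 2 by ring,
          Real.rpow_add h1]
        ring
    _ = _ := lintegral_const_mul _ (by fun_prop)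

theorem gaussianReal_zero_one_Ioi_zero : gaussianReal 0 1 (Set.Ioi 0) = 1 / 2 := by
  have : NullSingletonClass (gaussianReal 0 1) := nullSingletonClass_gaussianReal one_ne_zero
  have hsymm : gaussianReal 0 1 (Set.Iio 0) = gaussianReal 0 1 (Set.Ioi 0) := by
    conv_lhs => rw [← neg_zero, ← gaussianReal_map_neg]
    rw [Measure.map_apply measurable_neg measurableSet_Iio]
    congr 1
    ext t
    simp
  have hsum := measure_add_measure_compl (μ := gaussianReal 0 1) (measurableSet_Ioi (a := (0 : ℝ)))
  rw [Set.compl_Ioi, measure_congr Iio_ae_eq_Iic.symm, hsymm, measure_univ, ← two_mul] at hsum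
  rw [ENNReal.eq_div_iff (by simp) (by simp), hsum]

theorem intervalIntegrable_rpow_mul_one_sub_rpow {a b : ℝ} (ha : 0 < a) (hb : 0 < b) :
    IntervalIntegrable (fun x : ℝ => x ^ (a - 1) * (1 - x) ^ (b - 1)) volume 0 1 := by
  have h := Complex.betaIntegral_convergent (u := a) (v := b) (by simpa) (by simpa)
  rw [intervalIntegrable_iff_integrableOn_Ioc_of_le zero_le_one] at h ⊢
  refine h.re.congr ?_
  filter_upwards [ae_restrict_mem measurableSet_Ioc] with x hx
  have h1 : (0 : ℝ) ≤ 1 - x := sub_nonneg.2 hx.2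
  rw [show (1 : ℂ) - x = ((1 - x : ℝ) : ℂ) by push_cast; rfl,
    show (a : ℂ) - 1 = ((a - 1 : ℝ) : ℂ) by push_cast; rfl,
    show (b : ℂ) - 1 = ((b - 1 : ℝ) : ℂ) by push_cast; rfl,
    ← Complex.ofReal_cpow hx.1.le, ← Complex.ofReal_cpow h1, ← Complex.ofReal_mul]
  simp

theorem toReal_setLIntegral_Ioo_eq_sub {a b q : ℝ} (ha : 0 < a) (hb : 0 < b) (hq0 : 0 ≤ q)
    (hq1 : q ≤ 1) :
    (∫⁻ v in Set.Ioo q 1, ENNReal.ofReal (v ^ (a - 1) * (1 - v) ^ (b - 1))).toReal =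
      (∫ x in (0 : ℝ)..1, x ^ (a - 1) * (1 - x) ^ (b - 1)) -
        ∫ x in (0 : ℝ)..q, x ^ (a - 1) * (1 - x) ^ (b - 1) := by
  have hint := intervalIntegrable_rpow_mul_one_sub_rpow ha hb
  rw [intervalIntegral.integral_interval_sub_left hint
      (hint.mono_set (Set.uIcc_subset_uIcc_left (by simp [hq0, hq1]))),
    intervalIntegral.integral_of_le hq1, integral_Ioc_eq_integral_Ioo,
    integral_eq_lintegral_of_nonneg_ae]
  · filter_upwards [ae_restrict_mem measurableSet_Ioo] with x hx
    have h0 : 0 < x := hq0.trans_lt hx.1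
    have h1 : 0 < 1 - x := sub_pos.2 hx.2
    show 0 ≤ _
    positivity
  · exact Measurable.aestronglyMeasurable (by fun_prop)

theorem integral_rpow_mul_one_sub_rpow_pos {a b : ℝ} (ha : 0 < a) (hb : 0 < b) :
    0 < ∫ x in (0 : ℝ)..1, x ^ (a - 1) * (1 - x) ^ (b - 1) :=
  intervalIntegral.intervalIntegral_pos_of_pos_on (intervalIntegrable_rpow_mul_one_sub_rpow ha hb)
    (fun x hx => by
      have h0 : 0 < x := hx.1
      have h1 : 0 < 1 - x := sub_pos.2 hx.2
      positivity) zero_lt_one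

theorem toReal_gaussianReal_prod_pi_eq_betaCDF {ι : Type*} [Fintype ι] [Nonempty ι] {q : ℝ}
    (hq0 : 0 ≤ q) (hq1 : q < 1) :
    (((gaussianReal 0 1).prod (Measure.pi fun _ : ι => gaussianReal 0 1))
        {p | √(∑ i, p.2 i ^ 2) * √(q / (1 - q)) < p.1}).toReal =
      (1 - betaCDF (1 / 2) ((Fintype.card ι : ℝ) / 2) q) / 2 := by
  obtain ⟨A, hA⟩ := exists_gaussianReal_prod_pi_apply_eq (ι := ι)
  have ha : (0 : ℝ) < 1 / 2 := by norm_num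
  have hb : (0 : ℝ) < (Fintype.card ι : ℝ) / 2 := by
    have : (0 : ℝ) < Fintype.card ι := by exact_mod_cast Fintype.card_pos
    positivity
  have hB := integral_rpow_mul_one_sub_rpow_pos ha hb
  have hzero := congrArg ENNReal.toReal (hA 0 le_rfl zero_lt_one)
  have hset : {p : ℝ × (ι → ℝ) | √(∑ i, p.2 i ^ 2) * √(0 / (1 - 0)) < p.1} =
      Set.Ioi 0 ×ˢ Set.univ := by
    ext p
    simp
  rw [hset, Measure.prod_prod, gaussianReal_zero_one_Ioi_zero, measure_univ, ENNReal.toReal_mul,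
    ENNReal.toReal_mul,
    toReal_setLIntegral_Ioo_eq_sub ha hb le_rfl zero_le_one, intervalIntegral.integral_same,
    sub_zero] at hzero
  rw [hA q hq0 hq1, ENNReal.toReal_mul, toReal_setLIntegral_Ioo_eq_sub ha hb hq0 hq1.le, betaCDF]
  rw [show (1 / 2 : ENNReal).toReal = 1 / 2 by simp, ENNReal.toReal_one, mul_one] at hzero
  generalize (∫ x in (0 : ℝ)..1, x ^ ((1 / 2 : ℝ) - 1) *
    (1 - x) ^ ((Fintype.card ι : ℝ) / 2 - 1)) = B at hB hzero ⊢
  rw [← div_eq_iff hB.ne'] at hzero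
  rw [← hzero]
  field_simp

theorem betaCDF_one {a b : ℝ} (ha : 0 < a) (hb : 0 < b) : betaCDF a b 1 = 1 :=
  div_self (integral_rpow_mul_one_sub_rpow_pos ha hb).ne'

theorem lt_div_sqrt_sq_add_iff {r g S : ℝ} (hr0 : 0 ≤ r) (hr1 : r < 1) (hS : 0 < S) :
    r < g / √(g ^ 2 + S) ↔ √S * √(r ^ 2 / (1 - r ^ 2)) < g := by
  have hr : 0 < 1 - r ^ 2 := by nlinarith
  have hpos : 0 < g ^ 2 + S := by positivity
  rw [lt_div_iff₀ (Real.sqrt_pos.2 hpos), ← Real.sqrt_mul hS.le]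
  rcases le_or_gt g 0 with hg | hg
  · exact iff_of_false (not_lt.2 (hg.trans (by positivity))) (not_lt.2 (hg.trans (by positivity)))
  · rw [← abs_of_nonneg hr0, ← Real.sqrt_sq_eq_abs, ← Real.sqrt_mul (sq_nonneg r),
      Real.sqrt_lt' hg, Real.sqrt_lt' hg, Real.sqrt_sq_eq_abs, abs_of_nonneg hr0,
      mul_div_assoc', div_lt_iff₀ hr]
    constructor <;> intro h <;> linarith

theorem div_sqrt_sq_add_le_one {g S : ℝ} (hS : 0 ≤ S) : g / √(g ^ 2 + S) ≤ 1 :=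
  div_le_one_of_le₀ (Real.le_sqrt_of_sq_le (by linarith)) (Real.sqrt_nonneg _)

theorem Cmat_mulVec_apply {n : ℕ} (v : Fin n → ℝ) (i : Fin n) :
    (Cmat n *ᵥ v) i = v i - (∑ j, v j) / n := by
  simp [Cmat, mulVec, dotProduct, sub_mul, Finset.sum_sub_distrib, Finset.mul_sum,
    div_eq_inv_mul]

theorem sum_Cmat_mulVec {n : ℕ} (hn : n ≠ 0) (v : Fin n → ℝ) : ∑ i, (Cmat n *ᵥ v) i = 0 := by
  have : (n : ℝ) ≠ 0 := by exact_mod_cast hn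
  simp_rw [Cmat_mulVec_apply, Finset.sum_sub_distrib]
  simp
  field_simp
  simp

theorem enorm'_eq_norm {n : ℕ} (v : Fin n → ℝ) : enorm' v = ‖WithLp.toLp 2 v‖ := by
  simp [enorm', EuclideanSpace.norm_eq]

theorem exists_orthonormalBasis_corrR_eq {k : ℕ} (x : Fin (k + 2) → ℝ)
    (hx : Cmat (k + 2) *ᵥ x ≠ 0) :
    ∃ b : OrthonormalBasis (Fin (k + 2)) ℝ (EuclideanSpace ℝ (Fin (k + 2))),
      ∀ (α σ : ℝ) (z : Fin (k + 2) → ℝ), 0 < σ →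
        enorm' (Cmat (k + 2) *ᵥ fun i => α + σ * z i) =
          σ * √(inner ℝ (b 1) (WithLp.toLp 2 z) ^ 2 +
            ∑ j : Fin k, inner ℝ (b j.succ.succ) (WithLp.toLp 2 z) ^ 2) ∧
        corrR x (fun i => α + σ * z i) =
          inner ℝ (b 1) (WithLp.toLp 2 z) / √(inner ℝ (b 1) (WithLp.toLp 2 z) ^ 2 +
            ∑ j : Fin k, inner ℝ (b j.succ.succ) (WithLp.toLp 2 z) ^ 2) := by
  set u : EuclideanSpace ℝ (Fin (k + 2)) := WithLp.toLp 2 fun _ => (√(k + 2 : ℝ))⁻¹ with hu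
  set c : EuclideanSpace ℝ (Fin (k + 2)) := WithLp.toLp 2 (Cmat (k + 2) *ᵥ x) with hc
  have hk : (0 : ℝ) < k + 2 := by positivity
  have hc0 : c ≠ 0 := by simpa [hc] using hx
  have hcn : 0 < ‖c‖ := norm_pos_iff.2 hc0
  have inner_u (w : EuclideanSpace ℝ (Fin (k + 2))) :
      inner ℝ u w = (√(k + 2 : ℝ))⁻¹ * ∑ i, w i := by
    simp [hu, PiLp.inner_apply, Finset.mul_sum, mul_comm (w _)]
  have hu1 : ‖u‖ = 1 := by
    rw [EuclideanSpace.norm_eq]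
    simp [hu, Real.sq_sqrt hk.le]
    field_simp
  have huc : inner ℝ u c = 0 := by
    rw [inner_u]
    simp only [hc]
    rw [sum_Cmat_mulVec (by omega), mul_zero]
  let v : Fin (k + 2) → EuclideanSpace ℝ (Fin (k + 2)) := Fin.cons u fun _ => ‖c‖⁻¹ • c
  have hv : Orthonormal ℝ (Set.domRestrict ({0, 1} : Set (Fin (k + 2))) v) := by
    have hv0 : v 0 = u := rfl
    have hv1 : v 1 = ‖c‖⁻¹ • c := rfl
    constructor
    · rintro ⟨i, rfl | rfl⟩
      · simpa [hv0] using hu1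
      · simp [hv1, norm_smul, hcn.ne']
    · rintro ⟨i, rfl | rfl⟩ ⟨j, rfl | rfl⟩ hij
      · exact absurd rfl hij
      · simp [hv0, hv1, inner_smul_right, huc]
      · simp [hv0, hv1, inner_smul_left, real_inner_comm u c, huc]
      · exact absurd rfl hij
  obtain ⟨b, hb⟩ := hv.exists_orthonormalBasis_extension_of_card_eq (by simp)
  have hb0 : b 0 = u := hb 0 (by simp)
  have hb1 : b 1 = ‖c‖⁻¹ • c := hb 1 (by simp)
  refine ⟨b, fun α σ z hσ => ?_⟩
  set y : Fin (k + 2) → ℝ := fun i => α + σ * z i with hy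
  set d : EuclideanSpace ℝ (Fin (k + 2)) := WithLp.toLp 2 (Cmat (k + 2) *ᵥ y) with hd
  have hd0 : inner ℝ (b 0) d = 0 := by
    rw [hb0, inner_u]
    simp only [hd]
    rw [sum_Cmat_mulVec (by omega), mul_zero]
  have hdecomp : ∃ t : ℝ, d = σ • WithLp.toLp 2 z + t • u := by
    refine ⟨(α - (∑ j, y j) / (k + 2 : ℕ)) * √(k + 2 : ℝ), ?_⟩
    ext i
    simp only [hd, hu, Cmat_mulVec_apply, PiLp.add_apply, PiLp.smul_apply, smul_eq_mul]
    rw [mul_assoc, mul_inv_cancel₀ (Real.sqrt_pos.2 hk).ne']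
    simp only [hy]
    ring
  have hdi (i : Fin (k + 1)) : inner ℝ (b i.succ) d = σ * inner ℝ (b i.succ) (WithLp.toLp 2 z) := by
    obtain ⟨t, ht⟩ := hdecomp
    rw [ht, inner_add_right, inner_smul_right, inner_smul_right, ← hb0,
      b.inner_eq_zero (Fin.succ_ne_zero i), mul_zero, add_zero]
  have hnorm : ‖d‖ = σ * √(inner ℝ (b 1) (WithLp.toLp 2 z) ^ 2 +
            ∑ j : Fin k, inner ℝ (b j.succ.succ) (WithLp.toLp 2 z) ^ 2) := by
    rw [← Real.sqrt_sq (norm_nonneg d), ← b.sum_sq_inner_right d, Fin.sum_univ_succ, hd0]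
    simp_rw [hdi]
    rw [Fin.sum_univ_succ]
    simp_rw [mul_pow]
    rw [← Finset.mul_sum, ← mul_add, zero_pow two_ne_zero, zero_add,
      Real.sqrt_mul (by positivity), Real.sqrt_sq hσ.le]
    rfl
  refine ⟨by rw [enorm'_eq_norm, ← hnorm], ?_⟩
  have hdot : (Cmat (k + 2) *ᵥ x) ⬝ᵥ (Cmat (k + 2) *ᵥ y) =
      ‖c‖ * (σ * inner ℝ (b 1) (WithLp.toLp 2 z)) := by
    have h1 : (Cmat (k + 2) *ᵥ x) ⬝ᵥ (Cmat (k + 2) *ᵥ y) = inner ℝ c d := by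
      simp [hc, hd, PiLp.inner_apply, dotProduct, mul_comm]
    have h2 := hdi 0
    rw [Fin.succ_zero_eq_one] at h2
    rw [h1, ← h2, hb1, real_inner_smul_left, mul_inv_cancel_left₀ hcn.ne']
  rw [corrR, hdot, enorm'_eq_norm, enorm'_eq_norm, ← hc, ← hd, hnorm,
    mul_div_mul_left _ _ hcn.ne', mul_div_mul_left _ _ hσ.ne']

theorem measurePreserving_inner_orthonormalBasis_pi_gaussianReal {ι : Type*} [Fintype ι]
    (b : OrthonormalBasis ι ℝ (EuclideanSpace ℝ ι)) :
    MeasurePreserving (fun (z : ι → ℝ) i => inner ℝ (b i) (WithLp.toLp 2 z))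
      (Measure.pi fun _ => gaussianReal 0 1) (Measure.pi fun _ => gaussianReal 0 1) := by
  refine ⟨by fun_prop, ?_⟩
  have h := map_pi_eq_stdGaussian (ι := ι)
  rw [stdGaussian_eq_map_pi_orthonormalBasis b] at h
  have h' := congrArg (Measure.map fun (e : EuclideanSpace ℝ ι) i => inner ℝ (b i) e) h
  rw [Measure.map_map (by fun_prop) (by fun_prop), Measure.map_map (by fun_prop) (by fun_prop)] at h'
  refine h'.trans ?_
  convert! Measure.map_id using 2
  classical
  ext x i
  simp [inner_sum, inner_smul_right, b.inner_eq_ite]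

theorem measurePreserving_pi_fin_add_two {X : Type*} [MeasurableSpace X] (μ : Measure X)
    [IsProbabilityMeasure μ] (k : ℕ) :
    MeasurePreserving (fun g : Fin (k + 2) → X => (g 1, fun j : Fin k => g j.succ.succ))
      (Measure.pi fun _ => μ) (μ.prod (Measure.pi fun _ => μ)) :=
  (measurePreserving_piFinSuccAbove (fun _ : Fin (k + 1) => μ) 0).comp
    (measurePreserving_snd.comp (measurePreserving_piFinSuccAbove (fun _ : Fin (k + 2) => μ) 0))

theorem measurePreserving_standardize {ι : Type*} [Fintype ι] (α : ℝ) {σ : ℝ} (hσ : 0 < σ) :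
    MeasurePreserving (fun (y : ι → ℝ) i => σ⁻¹ * (y i - α))
      (Measure.pi fun _ => gaussianReal α (σ ^ 2).toNNReal)
      (Measure.pi fun _ => gaussianReal 0 1) := by
  refine measurePreserving_pi (f := fun (_ : ι) (t : ℝ) => σ⁻¹ * (t - α)) _ _
    fun i => ⟨by fun_prop, ?_⟩
  have h : (fun t : ℝ => σ⁻¹ * (t - α)) = (σ⁻¹ * ·) ∘ (· - α) := rfl
  rw [h, ← Measure.map_map (by fun_prop) (by fun_prop), gaussianReal_map_sub_const,
    gaussianReal_map_const_mul, sub_self, mul_zero]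
  congr 1
  rw [← NNReal.coe_inj]
  simp [Real.coe_toNNReal _ (sq_nonneg σ), hσ.ne']

/-- if `y ~ N(α·1ₙ, σ²·Iₙ)` and `Cx ≠ 0`, then `Cy ≠ 0` almost surely, and
for every `r ∈ [0, 1]` the correlation `R = (Cx)ᵀ(Cy)/(‖Cx‖·‖Cy‖)` satisfies
`P(R > r) = (1 − F(r²; 1/2, (n−2)/2))/2` for the beta CDF `F`. -/
theorem null_distribution_of_R {n : ℕ} (hn : 3 ≤ n) (x : Fin n → ℝ)
    (hx : Cmat n *ᵥ x ≠ 0) (α σ : ℝ) (hσ : 0 < σ)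
    {Ω : Type*} [MeasurableSpace Ω] (P : Measure Ω) [IsProbabilityMeasure P]
    (Y : Ω → (Fin n → ℝ)) (hYmeas : Measurable Y)
    (hYlaw : Measure.map Y P =
      Measure.pi fun _ : Fin n => gaussianReal α ((σ ^ 2).toNNReal)) :
    (∀ᵐ ω ∂P, Cmat n *ᵥ Y ω ≠ 0) ∧
    ∀ r : ℝ, r ∈ Set.Icc (0 : ℝ) 1 →
      (P {ω | r < corrR x (Y ω)}).toReal =
        (1 - betaCDF (1 / 2) (((n : ℝ) - 2) / 2) (r ^ 2)) / 2 := by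
  obtain ⟨k, rfl⟩ : ∃ k, n = k + 2 := ⟨n - 2, by omega⟩
  have : Nonempty (Fin k) := ⟨⟨0, by omega⟩⟩
  obtain ⟨b, hb⟩ := exists_orthonormalBasis_corrR_eq x hx
  set G : Ω → ℝ × (Fin k → ℝ) := fun ω =>
    (inner ℝ (b 1) (WithLp.toLp 2 fun i => σ⁻¹ * (Y ω i - α)),
      fun j => inner ℝ (b j.succ.succ) (WithLp.toLp 2 fun i => σ⁻¹ * (Y ω i - α))) with hG
  have hGlaw : MeasurePreserving G P
      ((gaussianReal 0 1).prod (Measure.pi fun _ => gaussianReal 0 1)) :=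
    (measurePreserving_pi_fin_add_two (gaussianReal 0 1) k).comp
      ((measurePreserving_inner_orthonormalBasis_pi_gaussianReal b).comp
        ((measurePreserving_standardize α hσ).comp ⟨hYmeas, hYlaw⟩))
  have hY (ω : Ω) : Y ω = fun i => α + σ * (σ⁻¹ * (Y ω i - α)) := by
    ext i
    rw [mul_inv_cancel_left₀ hσ.ne']
    ring
  have hnorm (ω : Ω) : enorm' (Cmat (k + 2) *ᵥ Y ω) =
      σ * √((G ω).1 ^ 2 + ∑ j, (G ω).2 j ^ 2) := by
    conv_lhs => rw [hY ω]
    exact (hb α σ _ hσ).1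
  have hcorr (ω : Ω) : corrR x (Y ω) = (G ω).1 / √((G ω).1 ^ 2 + ∑ j, (G ω).2 j ^ 2) := by
    conv_lhs => rw [hY ω]
    exact (hb α σ _ hσ).2
  have hpos : ∀ᵐ ω ∂P, 0 < ∑ j, (G ω).2 j ^ 2 := by
    have h := (measurePreserving_snd.comp hGlaw).quasiMeasurePreserving.ae
      (ae_pi_gaussianReal_sqrt_sum_sq_pos (ι := Fin k))
    filter_upwards [h] with ω hω using Real.sqrt_pos.1 hω
  refine ⟨?_, fun r hr => ?_⟩
  · filter_upwards [hpos] with ω hω h0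
    have hlt : 0 < enorm' (Cmat (k + 2) *ᵥ Y ω) := by
      rw [hnorm]
      positivity
    simp [h0, enorm'] at hlt
  · have hcast : ((k + 2 : ℕ) : ℝ) - 2 = (Fintype.card (Fin k) : ℝ) := by simp
    rw [hcast]
    rcases hr.2.lt_or_eq with hr1 | rfl
    · rw [← toReal_gaussianReal_prod_pi_eq_betaCDF (ι := Fin k) (sq_nonneg r)
        (by nlinarith [hr.1]), ← hGlaw.measure_preimage
          (measurableSet_lt (by fun_prop) (by fun_prop)).nullMeasurableSet]
      congr 1
      refine measure_congr ?_
      filter_upwards [hpos] with ω hω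
      refine propext ?_
      change r < corrR x (Y ω) ↔ √(∑ j, (G ω).2 j ^ 2) * √(r ^ 2 / (1 - r ^ 2)) < (G ω).1
      rw [hcorr, lt_div_sqrt_sq_add_iff hr.1 hr1 hω]
    · have hempty : {ω | 1 < corrR x (Y ω)} = ∅ := by
        ext ω
        simp only [Set.mem_ofPred_eq, Set.mem_empty_iff_false, iff_false, not_lt, hcorr]
        exact div_sqrt_sq_add_le_one (Finset.sum_nonneg fun j _ => sq_nonneg _)
      rw [hempty, one_pow, betaCDF_one one_half_pos
        (half_pos (by exact_mod_cast Fintype.card_pos))]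
      simp
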